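/- Let κ ≥ 2, let π ∈ ℝ^κ have all entries positive, and let U be a real κ×κ matrix whose first column is the all-ones vector and which satisfies Uᵀ·diag(π)·U = I. Suppose ν_{ijk} = Σ_l π_l U_{li} U_{lj} U_{lk} = 0 for all indices i, j, k ≥ 2. Then for all indices j ≠ k with j, k ≥ 2 and every row index l, the product U_{lj}·U_{lk} = 0. -/

import Mathlib

open Matrix in
/-- If all `ν_{ijk} = Σ_l π_l U_{li} U_{lj} U_{lk}` with `i, j, k ≥ 2` vanish, then for
distinct columns `j ≠ k` (both ≥ 2) the entrywise products `U_{lj}·U_{lk}` all vanish. -/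
theorem stmt5 (κ : ℕ) (hκ : 2 ≤ κ) (π : Fin κ → ℝ) (hπ : ∀ l, 0 < π l)
    (U : Matrix (Fin κ) (Fin κ) ℝ) (hκ0 : 0 < κ)
    (hU1 : ∀ l, U l ⟨0, hκ0⟩ = 1)
    (horth : Uᵀ * Matrix.diagonal π * U = 1)
    (hν : ∀ i j k : Fin κ, i ≠ ⟨0, hκ0⟩ → j ≠ ⟨0, hκ0⟩ → k ≠ ⟨0, hκ0⟩ →
      ∑ l, π l * U l i * U l j * U l k = 0) :
    ∀ j k : Fin κ, j ≠ ⟨0, hκ0⟩ → k ≠ ⟨0, hκ0⟩ → j ≠ k → ∀ l, U l j * U l k = 0 := by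
  intro j k hj hk hjk l
  have hinv : U * (Uᵀ * Matrix.diagonal π) = 1 := mul_eq_one_comm.mp horth
  have h0 : (Uᵀ * Matrix.diagonal π) *ᵥ (fun l => U l j * U l k) = 0 := by
    funext i
    simp only [Matrix.mulVec, dotProduct, Matrix.mul_diagonal, Matrix.transpose_apply,
      Pi.zero_apply]
    by_cases hi : i = ⟨0, hκ0⟩
    · subst hi
      have h := congrFun (congrFun horth j) k
      rw [Matrix.mul_apply, Matrix.one_apply_ne hjk] at h
      simp only [Matrix.mul_diagonal, Matrix.transpose_apply] at h
      rw [← h]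
      refine Finset.sum_congr rfl fun l _ => ?_
      rw [hU1 l]
      ring
    · rw [← hν i j k hi hj hk]
      refine Finset.sum_congr rfl fun l _ => ?_
      ring
  have h1 : (fun l => U l j * U l k) = 0 := by
    rw [← Matrix.one_mulVec (fun l => U l j * U l k), ← hinv, ← Matrix.mulVec_mulVec, h0,
      Matrix.mulVec_zero]
  exact congrFun h1 l
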